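/- Every group of square-free order n = ab is isomorphic to a semidirect product C_a ⋉ C_b of cyclic groups of coprime orders a and b. -/

import Mathlib

/-- Hölder: every group of square-free order is isomorphic to a semidirect product
`C_a ⋉ C_b` of cyclic groups of coprime orders. -/
theorem holder_squarefree (G : Type*) [Group G] [Finite G]
    (h : Squarefree (Nat.card G)) :
    ∃ (a b : ℕ), a * b = Nat.card G ∧ Nat.Coprime a b ∧
      ∃ φ : Multiplicative (ZMod a) →* MulAut (Multiplicative (ZMod b)),
        Nonempty (G ≃* SemidirectProduct (Multiplicative (ZMod b)) (Multiplicative (ZMod a)) φ) := by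
  have hz : IsZGroup G := IsZGroup.of_squarefree h
  obtain ⟨N, H, φ, e, hH, hN, hc⟩ := isZGroup_iff_exists_mulEquiv.mp hz
  refine ⟨Nat.card H, Nat.card N, ?_, hc.symm, _,
    ⟨e.trans (SemidirectProduct.congr' (zmodCyclicMulEquiv hN).symm
      (zmodCyclicMulEquiv hH).symm)⟩⟩
  rw [Nat.card_congr e.toEquiv, SemidirectProduct.card, mul_comm]
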